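/- Let λ_0, …, λ_5 be pairwise distinct complex numbers. Then Σ_{0≤i<j≤5} (λ_i + λ_j)^2 · P_3(λ_i,λ_j) · P_5(λ_i,λ_j) / D_{ij} = 1. -/

import Mathlib

open Finset in
/-- Bott denominator: `D_{ij} = ∏_{k ≠ i,j} (λ_i − λ_k)(λ_j − λ_k)`. -/
noncomputable def bottD {n : ℕ} (l : Fin n → ℂ) (i j : Fin n) : ℂ :=
  ∏ k ∈ (Finset.univ \ {i, j}), (l i - l k) * (l j - l k)

/-- `P_c(x,y) = Σ_{t=0}^{c−1} x^t y^{c−1−t}`. -/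
noncomputable def bottP (c : ℕ) (x y : ℂ) : ℂ :=
  ∑ t ∈ Finset.range c, x ^ t * y ^ (c - 1 - t)

/-- A symmetric function vanishing on the diagonal has twice its sum over `i < j` as full sum. -/
theorem sum_sum_eq_two_mul_sum_lt {ι R : Type*} [Fintype ι] [LinearOrder ι] [CommSemiring R]
    (g : ι → ι → R) (symm : ∀ i j, g i j = g j i) (diag : ∀ i, g i i = 0) :
    ∑ i, ∑ j, g i j =
      2 * ∑ p ∈ Finset.univ.filter (fun p : ι × ι => p.1 < p.2), g p.1 p.2 := by
  have swap : ∑ i, ∑ j, (if j < i then g i j else 0) = ∑ i, ∑ j, (if i < j then g i j else 0) := by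
    rw [Finset.sum_comm]
    simp only [symm]
  have split : ∀ i j, g i j = (if i < j then g i j else 0) + (if j < i then g i j else 0) := by
    intro i j
    rcases lt_trichotomy i j with h | rfl | h
    · simp [h, h.not_gt]
    · simp [diag]
    · simp [h, h.not_gt]
  rw [Finset.sum_filter, Fintype.sum_prod_type, two_mul]
  calc ∑ i, ∑ j, g i j
      = ∑ i, ∑ j, ((if i < j then g i j else 0) + (if j < i then g i j else 0)) :=
        Finset.sum_congr rfl fun i _ => Finset.sum_congr rfl fun j _ => split i j
    _ = _ := by simp only [Finset.sum_add_distrib, swap]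

/-- The power sums `∑ xᵢᵃ / ∏_{k ≠ i} (xᵢ - xₖ)` for `a` less than the number of nodes. -/
theorem sum_pow_div_prod_sub {ι F : Type*} [Fintype ι] [DecidableEq ι] [Field F] {v : ι → F}
    (hv : Function.Injective v) {a : ℕ} (ha : a < Fintype.card ι) :
    ∑ i, v i ^ a / ∏ j ∈ Finset.univ.erase i, (v i - v j) =
      if Fintype.card ι - 1 = a then 1 else 0 := by
  have h := Lagrange.coeff_eq_sum (s := Finset.univ) (v := v) hv.injOn
    (P := (Polynomial.X : Polynomial F) ^ a)
    (by rw [Polynomial.degree_X_pow, Finset.card_univ]; exact_mod_cast ha)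
  simpa [Polynomial.coeff_X_pow] using h.symm

theorem prod_erase_mul_prod_erase_eq_neg_sq_mul_bottD {n : ℕ} (l : Fin n → ℂ) {i j : Fin n}
    (hij : i ≠ j) :
    (∏ k ∈ Finset.univ.erase i, (l i - l k)) * ∏ k ∈ Finset.univ.erase j, (l j - l k) =
      -(l i - l j) ^ 2 * bottD l i j := by
  have hi : (Finset.univ : Finset (Fin n)) \ {i, j} = (Finset.univ.erase i).erase j := by
    ext; simp; tauto
  have hj : (Finset.univ.erase i).erase j = (Finset.univ.erase j).erase i :=
    Finset.erase_right_comm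
  rw [bottD, Finset.prod_mul_distrib, hi,
    ← Finset.mul_prod_erase (Finset.univ.erase i) _ (Finset.mem_erase.2 ⟨hij.symm, Finset.mem_univ j⟩),
    ← Finset.mul_prod_erase (Finset.univ.erase j) _ (Finset.mem_erase.2 ⟨hij, Finset.mem_univ i⟩),
    ← hj]
  ring

theorem sub_mul_bottP (c : ℕ) (x y : ℂ) : (x - y) * bottP c x y = x ^ c - y ^ c :=
  mul_comm (x - y) _ ▸ (Commute.all x y).geom_sum₂_mul c

/-- Bott's formula for `N_1(1,1,0,1) = 1` in ℙ⁵. -/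
theorem bott_sum_15 (l : Fin 6 → ℂ) (hl : Function.Injective l) :
    ∑ p ∈ Finset.univ.filter (fun p : Fin 6 × Fin 6 => p.1 < p.2),
      (l p.1 + l p.2) ^ 2 * bottP 3 (l p.1) (l p.2) * bottP 5 (l p.1) (l p.2) / bottD l p.1 p.2 = 1 := by
  set W : Fin 6 → ℂ := fun i => ∏ k ∈ Finset.univ.erase i, (l i - l k) with hW
  let m : ℕ → ℂ := fun a => ∑ i, l i ^ a / W i
  have hm : ∀ a < 6, m a = if 5 = a then 1 else 0 := fun a ha => by
    simpa using sum_pow_div_prod_sub hl (a := a) (by simpa using ha)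
  let g : Fin 6 → Fin 6 → ℂ := fun i j =>
    -((l i + l j) ^ 2 * (l i ^ 3 - l j ^ 3) * (l i ^ 5 - l j ^ 5)) / (W i * W j)
  have summand : ∀ p ∈ Finset.univ.filter (fun p : Fin 6 × Fin 6 => p.1 < p.2),
      (l p.1 + l p.2) ^ 2 * bottP 3 (l p.1) (l p.2) * bottP 5 (l p.1) (l p.2) / bottD l p.1 p.2 =
        g p.1 p.2 := by
    rintro ⟨i, j⟩ hp
    have hij : i ≠ j := (Finset.mem_filter.1 hp).2.ne
    have hsub : -(l i - l j) ^ 2 ≠ 0 := neg_ne_zero.2 (pow_ne_zero 2 (sub_ne_zero.2 (hl.ne hij)))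
    simp only [g, hW]
    rw [prod_erase_mul_prod_erase_eq_neg_sq_mul_bottD l hij, ← sub_mul_bottP, ← sub_mul_bottP,
      ← mul_div_mul_left _ (bottD l i j) hsub]
    congr 1
    ring
  have total : ∑ i, ∑ j, g i j = 2 := by
    have expand : ∀ i j, g i j =
        2 * (l i ^ 5 / W i * (l j ^ 5 / W j))
        - l i ^ 10 / W i * (l j ^ 0 / W j) - l i ^ 0 / W i * (l j ^ 10 / W j)
        - 2 * (l i ^ 9 / W i * (l j ^ 1 / W j)) - 2 * (l i ^ 1 / W i * (l j ^ 9 / W j))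
        - l i ^ 8 / W i * (l j ^ 2 / W j) - l i ^ 2 / W i * (l j ^ 8 / W j)
        + l i ^ 7 / W i * (l j ^ 3 / W j) + l i ^ 3 / W i * (l j ^ 7 / W j)
        + 2 * (l i ^ 6 / W i * (l j ^ 4 / W j)) + 2 * (l i ^ 4 / W i * (l j ^ 6 / W j)) := by
      intro i j
      simp only [g]
      ring
    have moments : ∑ i, ∑ j, g i j =
        2 * (m 5 * m 5) - m 10 * m 0 - m 0 * m 10 - 2 * (m 9 * m 1) - 2 * (m 1 * m 9)
        - m 8 * m 2 - m 2 * m 8 + m 7 * m 3 + m 3 * m 7 + 2 * (m 6 * m 4) + 2 * (m 4 * m 6) := by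
      simp only [expand, Finset.sum_add_distrib, Finset.sum_sub_distrib, ← Finset.mul_sum,
        ← Finset.sum_mul, m]
    rw [moments, hm 0, hm 1, hm 2, hm 3, hm 4, hm 5] <;> norm_num
  have double := sum_sum_eq_two_mul_sum_lt g (fun i j => by simp only [g]; ring)
    (fun i => by simp [g])
  rw [Finset.sum_congr rfl summand]
  rw [total] at double
  linear_combination -double / 2
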